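/- arXiv:1601.00343 — 3 statements merged into one kernel-verified Lean document; each statement's English description precedes it below -/
import Mathlib

section
/- Let p be a prime and let G = ∏_{i=1}^∞ C_{p^i} be the direct product of cyclic groups of orders p, p², p³, …, equipped with the product topology (each factor discrete). Then there exists an isomorphism of abstract groups between G and G × ℤ_p, where ℤ_p is the additive group of p-adic integers, but there is no continuous group isomorphism between G and G × ℤ_p. -/
open Filter Topology

/-- A split surjection of additive groups decomposes its source as kernel times target. -/
noncomputable def AddMonoidHom.equivKerProdOfRightInverse {A B : Type*} [AddCommGroup A]
    [AddCommGroup B] (r : A →+ B) (s : B →+ A) (h : ∀ b, r (s b) = b) : A ≃+ r.ker × B where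
  toFun a := (⟨a - s (r a), by simp [AddMonoidHom.mem_ker, h]⟩, r a)
  invFun x := x.1 + s x.2
  left_inv a := by simp
  right_inv x := by
    obtain ⟨⟨k, hk⟩, b⟩ := x
    rw [AddMonoidHom.mem_ker] at hk
    simp [hk, h]
  map_add' a b := by
    ext
    · simp only [map_add, Prod.fst_add, AddSubgroup.coe_add]
      abel
    · simp

/-- Prepending an entry to a sequence, as an additive equivalence. -/
def AddEquiv.natPiProd (B : Type*) [AddCommGroup B] : (ℕ → B) ≃+ (ℕ → B) × B where
  toFun f := (fun n => f (n + 1), f 0)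
  invFun x n := Nat.casesOn n x.2 x.1
  left_inv f := by
    funext n
    cases n <;> rfl
  right_inv _ := rfl
  map_add' _ _ := rfl

/-- A group with the group of sequences in `B` as a direct summand absorbs a factor `B`. -/
theorem AddEquiv.nonempty_prod_of_rightInverse {A B : Type*} [AddCommGroup A] [AddCommGroup B]
    (r : A →+ (ℕ → B)) (s : (ℕ → B) →+ A) (h : ∀ b, r (s b) = b) : Nonempty (A ≃+ A × B) :=
  let e := r.equivKerProdOfRightInverse s h
  ⟨e.trans <| ((AddEquiv.refl _).prodCongr (AddEquiv.natPiProd B)).trans <|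
    AddEquiv.prodAssoc.symm.trans <| e.symm.prodCongr (AddEquiv.refl B)⟩

section PadicInt

variable {p : ℕ} [Fact p.Prime]

theorem PadicInt.tendsto_zero_of_toZModPow_eq_zero {l : Filter ℕ} {g : ℕ → ℕ}
    (hg : Tendsto g l atTop) {u : ℕ → ℤ_[p]}
    (hu : ∀ k, PadicInt.toZModPow (g k + 1) (u k) = 0) : Tendsto u l (𝓝 0) := by
  have hp : 1 < (p : ℝ) := mod_cast (Fact.out : p.Prime).one_lt
  refine squeeze_zero_norm (a := fun k => ((p : ℝ)⁻¹) ^ (g k + 1)) (fun k => ?_) ?_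
  · have := (PadicInt.norm_le_pow_iff_mem_span_pow (u k) (g k + 1)).2
      (by rw [← PadicInt.ker_toZModPow]; exact hu k)
    rwa [zpow_neg, zpow_natCast, ← inv_pow] at this
  · exact (tendsto_pow_atTop_nhds_zero_of_lt_one (by positivity) (inv_lt_one_of_one_lt₀ hp)).comp
      ((tendsto_add_atTop_nat 1).comp hg)

theorem PadicInt.exists_tendsto_ultrafilter (U : Ultrafilter ℕ) (u : ℕ → ℤ_[p]) :
    ∃ a, Tendsto u U (𝓝 a) := by
  obtain ⟨a, -, ha⟩ := isCompact_univ.ultrafilter_le_nhds (U.map u) (by simp)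
  exact ⟨a, ha⟩

theorem PadicInt.toZModPow_natCast_val (n : ℕ) (x : ZMod (p ^ n)) :
    PadicInt.toZModPow n ((x.val : ℕ) : ℤ_[p]) = x := by
  have : NeZero (p ^ n) := ⟨pow_ne_zero _ (Fact.out : p.Prime).ne_zero⟩
  simp

/-- For a sequence `g` of indices tending to infinity along an ultrafilter, the limit along that
ultrafilter of the entries with index in `g` is a homomorphism `∏ C_{p^i} → ℤ_p`. -/
theorem PadicInt.exists_ultrafilter_limit_hom (U : Ultrafilter ℕ) {g : ℕ → ℕ}
    (hg : Tendsto g U atTop) : ∃ L : ((i : ℕ) → ZMod (p ^ (i + 1))) →+ ℤ_[p],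
      ∀ (x : (i : ℕ) → ZMod (p ^ (i + 1))) (a : ℤ_[p]),
        (∀ k, x (g k) = PadicInt.toZModPow (g k + 1) a) → L x = a := by
  choose L hL using fun x : (i : ℕ) → ZMod (p ^ (i + 1)) =>
    exists_tendsto_ultrafilter U fun k => (((x (g k)).val : ℕ) : ℤ_[p])
  refine ⟨AddMonoidHom.mk' L fun x y => ?_, fun x a hx => ?_⟩
  · refine sub_eq_zero.1 <| tendsto_nhds_unique ((hL (x + y)).sub ((hL x).add (hL y))) <|
      tendsto_zero_of_toZModPow_eq_zero hg fun k => ?_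
    simp only [map_sub, map_add, toZModPow_natCast_val, Pi.add_apply, sub_self]
  · refine sub_eq_zero.1 <| tendsto_nhds_unique ((hL x).sub tendsto_const_nhds) <|
      tendsto_zero_of_toZModPow_eq_zero hg fun k => ?_
    simp only [map_sub, toZModPow_natCast_val, hx, sub_self]

theorem nonempty_prod_cyclic_addEquiv_prod_padicInt (p : ℕ) [Fact p.Prime] :
    Nonempty (((i : ℕ) → ZMod (p ^ (i + 1))) ≃+
      (((i : ℕ) → ZMod (p ^ (i + 1))) × ℤ_[p])) := by
  have hg (j : ℕ) : Tendsto (Nat.pair j) (hyperfilter ℕ) atTop :=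
    (tendsto_atTop_mono (fun k => Nat.right_le_pair j k) tendsto_id).mono_left
      Nat.hyperfilter_le_atTop
  choose L hL using fun j => PadicInt.exists_ultrafilter_limit_hom (p := p) _ (hg j)
  refine AddEquiv.nonempty_prod_of_rightInverse (AddMonoidHom.pi L)
    (AddMonoidHom.pi fun i => (PadicInt.toZModPow (i + 1)).toAddMonoidHom.comp
      (Pi.evalAddMonoidHom _ (Nat.unpair i).1)) fun a => ?_
  funext j
  exact hL j _ _ fun k => by simp

/-- Torsion is dense in `∏ C_{p^i}`, so continuous homomorphisms to torsion-free groups vanish. -/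
theorem eq_zero_of_continuous_prod_cyclic {B : Type*} [AddCommGroup B] [TopologicalSpace B]
    [T2Space B] [IsAddTorsionFree B] (f : ((i : ℕ) → ZMod (p ^ (i + 1))) →+ B)
    (hf : Continuous f) : f = 0 := by
  ext x
  have ht : Tendsto (fun n i => if i < n then x i else 0) atTop (𝓝 x) :=
    tendsto_pi_nhds.2 fun i => tendsto_const_nhds.congr' <| by
      filter_upwards [eventually_gt_atTop i] with n hn
      simp [hn]
  refine tendsto_nhds_unique ((hf.tendsto x).comp ht) (tendsto_const_nhds.congr fun n => ?_)
  have hp : p ^ n ≠ 0 := pow_ne_zero _ (Fact.out : p.Prime).ne_zero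
  refine ((nsmul_eq_zero_iff_right hp).1 ?_).symm
  rw [Function.comp_apply, ← map_nsmul]
  convert map_zero f
  funext i
  by_cases hi : i < n
  · have : ((p ^ n : ℕ) : ZMod (p ^ (i + 1))) = 0 :=
      (ZMod.natCast_eq_zero_iff _ _).2 (pow_dvd_pow p hi)
    simp only [Pi.smul_apply, hi, if_true, nsmul_eq_mul, this, zero_mul, Pi.zero_apply]
  · simp [hi]

end PadicInt

/-- The pro-`p` group `G = ∏_{i=1}^∞ C_{p^i}` is abstractly isomorphic to `G × ℤ_p`
(as an abstract group), but there is no continuous group isomorphism between `G` and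
`G × ℤ_p`. -/
theorem prod_cyclic_abstractly_iso_but_not_continuously_iso
    (p : ℕ) [Fact p.Prime] :
    Nonempty (((i : ℕ) → ZMod (p ^ (i + 1))) ≃+
        (((i : ℕ) → ZMod (p ^ (i + 1))) × ℤ_[p])) ∧
    ¬ ∃ e : ((i : ℕ) → ZMod (p ^ (i + 1))) ≃+
        (((i : ℕ) → ZMod (p ^ (i + 1))) × ℤ_[p]), Continuous e := by
  refine ⟨nonempty_prod_cyclic_addEquiv_prod_padicInt p, fun ⟨e, he⟩ => ?_⟩
  have h := eq_zero_of_continuous_prod_cyclic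
    ((AddMonoidHom.snd _ ℤ_[p]).comp e.toAddMonoidHom) (continuous_snd.comp he)
  simpa using DFunLike.congr_fun h (e.symm (0, 1))
end

section
/- Let p be a prime. There exists a surjective homomorphism of abstract groups from the additive group ℤ_p of p-adic integers onto the additive group ℚ of rational numbers. -/
/-- The rational numbers do not exhaust `ℚ_p`, which is uncountable. -/
theorem Padic.exists_notMem_range_ratCast (p : ℕ) [Fact p.Prime] :
    ∃ v : ℚ_[p], ∀ r : ℚ, (r : ℚ_[p]) ≠ v := by
  by_contra! h
  have hcard := continuum_le_cardinal_of_nontriviallyNormedField ℚ_[p]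
  have hcount : Countable ℚ_[p] := Function.Surjective.countable (f := fun r : ℚ ↦ (r : ℚ_[p])) h
  exact absurd (hcard.trans (Cardinal.mk_le_aleph0_iff.mpr hcount))
    (not_le.mpr Cardinal.aleph0_lt_continuum)

/-- The procyclic group `ℤ_p` maps (non-continuously) onto `ℚ`: there is a surjective
homomorphism of abstract additive groups from `ℤ_p` onto `ℚ`. -/
theorem exists_surjective_addHom_padicInt_to_rat (p : ℕ) [Fact p.Prime] :
    ∃ f : ℤ_[p] →+ ℚ, Function.Surjective f := by
  obtain ⟨v, hv⟩ := Padic.exists_notMem_range_ratCast p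
  have hmem : v ∉ Submodule.span ℚ {(1 : ℚ_[p])} := by
    rw [Submodule.mem_span_singleton]
    rintro ⟨r, hr⟩
    exact hv r (by simpa [Rat.smul_def] using hr)
  obtain ⟨g, hgv, hg⟩ := Submodule.exists_le_ker_of_notMem hmem
  have hg_rat (q : ℚ) : g q = 0 := by
    refine hg (Submodule.mem_span_singleton.mpr ⟨q, ?_⟩)
    simp [Rat.smul_def]
  refine ⟨g.toAddMonoidHom.comp (PadicInt.Coe.ringHom (p := p)).toAddMonoidHom, fun r ↦ ?_⟩
  obtain ⟨q, hq⟩ := Padic.rat_dense p ((r / g v) • v) one_pos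
  refine ⟨⟨(r / g v) • v - q, hq.le⟩, ?_⟩
  change g ((r / g v) • v - q) = r
  rw [map_sub, map_smul, hg_rat, sub_zero, smul_eq_mul, div_mul_cancel₀ r hgv]
end

section
/- Let Γ be a finite group and let ℓ be a positive integer such that every real linear representation of Γ of dimension strictly less than ℓ is trivial (i.e., ℓ is at most the minimal dimension of a non-trivial ℝ-linear representation of Γ). Let t ≥ 3 and let X₁, …, X_t be subsets of Γ satisfying |X₁| ⋯ |X_t| · ℓ^{t-2} ≥ |Γ|^t. Then X₁ ⋯ X_t = { x₁ ⋯ x_t | x_i ∈ X_i for 1 ≤ i ≤ t } = Γ. -/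
section GroupConvolution

variable {G : Type} [Group G] [Fintype G]

/-- Convolution of real functions on a finite group. -/
def groupConv (f v : G → ℝ) (x : G) : ℝ := ∑ z, f (x * z⁻¹) * v z

/-- The function `v` minus its mean. -/
noncomputable def centered (v : G → ℝ) (x : G) : ℝ := v x - (∑ y, v y) / Fintype.card G

lemma sum_mul_inv_left (f : G → ℝ) (x : G) : ∑ z, f (x * z⁻¹) = ∑ y, f y :=
  Fintype.sum_equiv ((Equiv.inv G).trans (Equiv.mulLeft x)) _ _ fun _ => rfl

lemma sum_mul_right (f : G → ℝ) (x : G) : ∑ z, f (z * x) = ∑ y, f y :=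
  Fintype.sum_equiv (Equiv.mulRight x) _ _ fun _ => rfl

lemma sum_groupConv (f v : G → ℝ) : ∑ x, groupConv f v x = (∑ x, f x) * ∑ x, v x := by
  unfold groupConv
  rw [Finset.sum_comm, Finset.mul_sum]
  refine Finset.sum_congr rfl fun z _ => ?_
  rw [← Finset.sum_mul, sum_mul_right f]

lemma card_cast_ne_zero_of_group : (Fintype.card G : ℝ) ≠ 0 := by
  exact_mod_cast Fintype.card_ne_zero

lemma sum_centered (v : G → ℝ) : ∑ x, centered v x = 0 := by
  have := card_cast_ne_zero_of_group (G := G)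
  simp only [centered, Finset.sum_sub_distrib, Finset.sum_const, Finset.card_univ, nsmul_eq_mul]
  field_simp
  ring

lemma centered_groupConv (f v : G → ℝ) (x : G) :
    centered (groupConv f v) x = groupConv (centered f) (centered v) x := by
  have := card_cast_ne_zero_of_group (G := G)
  have h : groupConv (centered f) (centered v) x =
      groupConv f v x - (∑ z, f (x * z⁻¹)) * ((∑ y, v y) / Fintype.card G)
        - (∑ y, f y) / Fintype.card G * (∑ z, v z)
        + Fintype.card G * ((∑ y, f y) / Fintype.card G * ((∑ y, v y) / Fintype.card G)) := by
    simp only [groupConv, centered, sub_mul, mul_sub, Finset.sum_sub_distrib, ← Finset.mul_sum,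
      ← Finset.sum_mul, Finset.sum_const, Finset.card_univ, nsmul_eq_mul]
    ring
  rw [h, sum_mul_inv_left, centered, sum_groupConv]
  field_simp
  ring

lemma groupConv_sq_le (f v : G → ℝ) (x : G) :
    groupConv f v x ^ 2 ≤ (∑ y, f y ^ 2) * ∑ y, v y ^ 2 := by
  rw [← sum_mul_inv_left (fun y => f y ^ 2) x]
  exact Finset.sum_mul_sq_le_sq_mul_sq _ _ _

/-- Convolution by `f` as a linear operator on `ℓ²(G)`. -/
noncomputable def groupConvLin (f : G → ℝ) : EuclideanSpace ℝ G →ₗ[ℝ] EuclideanSpace ℝ G where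
  toFun v := WithLp.toLp 2 (groupConv f v)
  map_add' v w := by
    ext x
    simp [groupConv, mul_add, Finset.sum_add_distrib]
  map_smul' c v := by
    ext x
    simp [groupConv, Finset.mul_sum, mul_left_comm]

/-- The right regular representation on `ℓ²(G)`. -/
noncomputable def rightRegular : Representation ℝ G (EuclideanSpace ℝ G) where
  toFun g :=
    { toFun := fun v => WithLp.toLp 2 fun x => v (x * g)
      map_add' := fun v w => by ext x; simp
      map_smul' := fun c v => by ext x; simp }
  map_one' := by ext v x; simp
  map_mul' g h := by
    apply LinearMap.ext
    intro v
    ext x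
    simp [mul_assoc]

@[simp] lemma groupConvLin_apply (f : G → ℝ) (v : EuclideanSpace ℝ G) (x : G) :
    groupConvLin f v x = groupConv f v x := rfl

@[simp] lemma rightRegular_apply {H : Type} [Group H] (g : H) (v : EuclideanSpace ℝ H) (x : H) :
    rightRegular g v x = v (x * g) := rfl

lemma groupConvLin_rightRegular (f : G → ℝ) (g : G) (v : EuclideanSpace ℝ G) :
    groupConvLin f (rightRegular g v) = rightRegular g (groupConvLin f v) := by
  ext x
  simp only [groupConvLin_apply, rightRegular_apply, groupConv]
  refine Fintype.sum_equiv (Equiv.mulRight g) _ _ fun z => ?_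
  simp

lemma inner_rightRegular (g : G) (v w : EuclideanSpace ℝ G) :
    inner ℝ (rightRegular g v) w = inner ℝ v (rightRegular g⁻¹ w) := by
  simp only [PiLp.inner_apply, rightRegular_apply]
  refine Fintype.sum_equiv (Equiv.mulRight g) _ _ fun z => ?_
  simp

/-- The operator `T* T`, where `T` is convolution by `f`. -/
noncomputable def groupConvSq (f : G → ℝ) : EuclideanSpace ℝ G →ₗ[ℝ] EuclideanSpace ℝ G :=
  (groupConvLin f).adjoint ∘ₗ groupConvLin f

lemma inner_groupConvSq (f : G → ℝ) (v w : EuclideanSpace ℝ G) :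
    inner ℝ (groupConvSq f v) w = inner ℝ (groupConvLin f v) (groupConvLin f w) := by
  simp [groupConvSq, LinearMap.adjoint_inner_left]

lemma groupConvSq_isSymmetric (f : G → ℝ) : (groupConvSq f).IsSymmetric := fun v w => by
  rw [inner_groupConvSq, real_inner_comm, ← inner_groupConvSq, real_inner_comm]

lemma groupConvSq_rightRegular (f : G → ℝ) (g : G) (v : EuclideanSpace ℝ G) :
    groupConvSq f (rightRegular g v) = rightRegular g (groupConvSq f v) := by
  refine ext_inner_right ℝ fun w => ?_
  rw [inner_groupConvSq, groupConvLin_rightRegular, inner_rightRegular, inner_rightRegular,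
    inner_groupConvSq, groupConvLin_rightRegular]

/-- The right regular representation restricted to an eigenspace of `T* T`. -/
noncomputable def eigenspaceRep (f : G → ℝ) (μ : ℝ) :
    Representation ℝ G (Module.End.eigenspace (groupConvSq f) μ) where
  toFun g := (rightRegular g).restrict fun v hv => by
    rw [Module.End.mem_eigenspace_iff] at hv ⊢
    rw [groupConvSq_rightRegular, hv, map_smul]
  map_one' := by
    apply LinearMap.ext
    intro v
    apply Subtype.ext
    simp
  map_mul' g h := by
    apply LinearMap.ext
    intro v
    apply Subtype.ext
    simp

lemma le_finrank_eigenspace {ℓ : ℕ}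
    (hrep : ∀ (V : Type) [AddCommGroup V] [Module ℝ V] [FiniteDimensional ℝ V],
      Module.finrank ℝ V < ℓ → ∀ ρ : Representation ℝ G V, ∀ g : G, ρ g = 1)
    {f : G → ℝ} (hf : ∑ x, f x = 0) {μ : ℝ} (hμ : μ ≠ 0)
    (hev : Module.End.HasEigenvalue (groupConvSq f) μ) :
    ℓ ≤ Module.finrank ℝ (Module.End.eigenspace (groupConvSq f) μ) := by
  by_contra! hlt
  obtain ⟨v, hv, hv0⟩ := hev.exists_hasEigenvector
  have hconst (g : G) : v g = v 1 := by
    have h := congrArg Subtype.val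
      (LinearMap.congr_fun (hrep _ hlt (eigenspaceRep f μ) g) ⟨v, hv⟩)
    have h' : rightRegular g v = v := h
    simpa using congrArg (fun w : EuclideanSpace ℝ G => w 1) h'
  have hT : groupConvLin f v = 0 := by
    ext x
    simp only [groupConvLin_apply, groupConv, hconst]
    rw [← Finset.sum_mul, sum_mul_inv_left, hf]
    simp
  have hS : μ • v = 0 := by
    rw [← Module.End.mem_eigenspace_iff.1 hv, groupConvSq, LinearMap.comp_apply, hT, map_zero]
  exact hv0 ((smul_eq_zero.1 hS).resolve_left hμ)

/-- A Hilbert–Schmidt bound on the sum of `‖T e‖²` over an orthonormal family. -/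
lemma sum_norm_groupConvLin_sq_le (f : G → ℝ) {ι : Type*} [Fintype ι]
    {e : ι → EuclideanSpace ℝ G} (he : Orthonormal ℝ e) :
    ∑ j, ‖groupConvLin f (e j)‖ ^ 2 ≤ Fintype.card G * ∑ x, f x ^ 2 := by
  have hrow (x : G) : ∑ j, groupConv f (e j) x ^ 2 ≤ ∑ y, f y ^ 2 := by
    have h := he.sum_inner_products_le (s := Finset.univ)
      (WithLp.toLp 2 fun z => f (x * z⁻¹) : EuclideanSpace ℝ G)
    rw [EuclideanSpace.real_norm_sq_eq] at h
    simp only [sum_mul_inv_left (fun y => f y ^ 2) x] at h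
    refine le_trans (le_of_eq (Finset.sum_congr rfl fun j _ => ?_)) h
    simp [groupConv, PiLp.inner_apply]
  simp only [EuclideanSpace.real_norm_sq_eq, groupConvLin_apply]
  rw [Finset.sum_comm]
  calc _ ≤ ∑ _x : G, ∑ y, f y ^ 2 := Finset.sum_le_sum fun x _ => hrow x
    _ = _ := by simp

lemma mul_eigenvalue_groupConvSq_le {ℓ : ℕ}
    (hrep : ∀ (V : Type) [AddCommGroup V] [Module ℝ V] [FiniteDimensional ℝ V],
      Module.finrank ℝ V < ℓ → ∀ ρ : Representation ℝ G V, ∀ g : G, ρ g = 1)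
    {f : G → ℝ} (hf : ∑ x, f x = 0) {μ : ℝ}
    (hev : Module.End.HasEigenvalue (groupConvSq f) μ) :
    ℓ * μ ≤ Fintype.card G * ∑ x, f x ^ 2 := by
  have hnonneg : 0 ≤ Fintype.card G * ∑ x, f x ^ 2 := by positivity
  rcases le_or_gt μ 0 with hμ | hμ
  · exact (mul_nonpos_of_nonneg_of_nonpos (by positivity) hμ).trans hnonneg
  have hdim : (ℓ : ℝ) ≤ Module.finrank ℝ (Module.End.eigenspace (groupConvSq f) μ) := by
    exact_mod_cast le_finrank_eigenspace hrep hf hμ.ne' hev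
  let b := stdOrthonormalBasis ℝ (Module.End.eigenspace (groupConvSq f) μ)
  have hb : Orthonormal ℝ fun j => (b j : EuclideanSpace ℝ G) :=
    b.orthonormal.comp_linearIsometry (Submodule.subtypeₗᵢ _)
  have hnorm (j) : ‖groupConvLin f (b j)‖ ^ 2 = μ := by
    rw [← real_inner_self_eq_norm_sq, ← inner_groupConvSq,
      Module.End.mem_eigenspace_iff.1 (b j).2, real_inner_smul_left, real_inner_self_eq_norm_sq,
      hb.1 j]
    simp
  have h := sum_norm_groupConvLin_sq_le f hb
  simp only [hnorm, Finset.sum_const, Finset.card_univ, Fintype.card_fin, nsmul_eq_mul] at h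
  exact (mul_le_mul_of_nonneg_right hdim hμ.le).trans h

/-- **Babai–Nikolov–Pyber mixing inequality** for a group whose non-trivial real representations
have dimension at least `ℓ`. -/
lemma sum_groupConv_sq_le {ℓ : ℕ}
    (hrep : ∀ (V : Type) [AddCommGroup V] [Module ℝ V] [FiniteDimensional ℝ V],
      Module.finrank ℝ V < ℓ → ∀ ρ : Representation ℝ G V, ∀ g : G, ρ g = 1)
    {f : G → ℝ} (hf : ∑ x, f x = 0) (v : G → ℝ) :
    ℓ * ∑ x, groupConv f v x ^ 2 ≤ Fintype.card G * (∑ x, f x ^ 2) * ∑ x, v x ^ 2 := by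
  have hS := groupConvSq_isSymmetric f
  let b := hS.eigenvectorBasis rfl
  let w : EuclideanSpace ℝ G := WithLp.toLp 2 v
  have hTw : ∑ x, groupConv f v x ^ 2 = ∑ j, hS.eigenvalues rfl j * inner ℝ (b j) w ^ 2 := by
    have h : ∑ x, groupConv f v x ^ 2 = inner ℝ w (groupConvSq f w) := by
      rw [real_inner_comm, inner_groupConvSq, real_inner_self_eq_norm_sq,
        EuclideanSpace.real_norm_sq_eq]
      rfl
    rw [h, ← b.sum_inner_mul_inner]
    refine Finset.sum_congr rfl fun j _ => ?_
    rw [← hS, hS.apply_eigenvectorBasis, real_inner_comm]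
    simp only [RCLike.ofReal_real_eq_id, id, real_inner_smul_left]
    ring
  have hw : ∑ x, v x ^ 2 = ∑ j, inner ℝ (b j) w ^ 2 := by
    have h := b.sum_sq_norm_inner_right w
    simp only [Real.norm_eq_abs, sq_abs] at h
    rw [h, EuclideanSpace.real_norm_sq_eq]
  rw [hTw, hw, Finset.mul_sum, Finset.mul_sum]
  refine Finset.sum_le_sum fun j _ => ?_
  rw [← mul_assoc]
  exact mul_le_mul_of_nonneg_right
    (mul_eigenvalue_groupConvSq_le hrep hf (hS.hasEigenvalue_eigenvalues rfl j)) (sq_nonneg _)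

/-- The squared `ℓ²`-distance of the indicator function of `A` to the constant functions. -/
noncomputable def indicatorVariance (A : Set G) : ℝ :=
  ∑ x, centered (A.indicator 1) x ^ 2

lemma sum_indicator_one {α : Type*} [Fintype α] (A : Set α) :
    ∑ x, A.indicator (1 : α → ℝ) x = Nat.card A := by
  classical
  simp [Set.indicator_apply, Nat.card_eq_fintype_card, Fintype.card_subtype]

lemma indicatorVariance_nonneg {α : Type} [Fintype α] (A : Set α) : 0 ≤ indicatorVariance A :=
  Finset.sum_nonneg fun _ _ => sq_nonneg _

lemma indicatorVariance_lt {A : Set G} (hA : 0 < Nat.card A) :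
    indicatorVariance A < Nat.card A := by
  have hn : (0 : ℝ) < Fintype.card G := by exact_mod_cast Fintype.card_pos
  have hA' : (0 : ℝ) < Nat.card A := by exact_mod_cast hA
  have h : indicatorVariance A = Nat.card A - (Nat.card A : ℝ) ^ 2 / Fintype.card G := by
    have hsq (x : G) : centered (A.indicator 1) x ^ 2 = A.indicator (1 : G → ℝ) x
        - 2 * (Nat.card A / Fintype.card G) * A.indicator (1 : G → ℝ) x
        + (Nat.card A / Fintype.card G : ℝ) ^ 2 := by
      rw [centered, sum_indicator_one]
      by_cases hx : x ∈ A
      all_goals simp only [hx, Set.indicator_of_mem, Set.indicator_of_notMem, not_false_eq_true,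
        Pi.one_apply]; ring
    simp only [indicatorVariance, hsq, Finset.sum_add_distrib, Finset.sum_sub_distrib,
      ← Finset.mul_sum, sum_indicator_one, Finset.sum_const, Finset.card_univ, nsmul_eq_mul]
    field_simp
    ring
  rw [h]
  have : 0 < (Nat.card A : ℝ) ^ 2 / Fintype.card G := by positivity
  linarith

lemma exists_eq_mul_of_groupConv_indicator_ne_zero {A : Set G} {v : G → ℝ} {x : G}
    (h : groupConv (A.indicator 1) v x ≠ 0) : ∃ a ∈ A, ∃ z, v z ≠ 0 ∧ x = a * z := by
  obtain ⟨z, -, hz⟩ := Finset.exists_ne_zero_of_sum_ne_zero h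
  exact ⟨x * z⁻¹, Set.mem_of_indicator_ne_zero (left_ne_zero_of_mul hz), z,
    right_ne_zero_of_mul hz, by simp⟩

/-- The iterated convolution of indicator functions is supported on the product set and is close
to its mean. -/
lemma exists_supported_on_prod {ℓ : ℕ}
    (hrep : ∀ (V : Type) [AddCommGroup V] [Module ℝ V] [FiniteDimensional ℝ V],
      Module.finrank ℝ V < ℓ → ∀ ρ : Representation ℝ G V, ∀ g : G, ρ g = 1)
    (k : ℕ) (X : Fin (k + 1) → Set G) :
    ∃ v : G → ℝ,
      (∀ g, v g ≠ 0 → ∃ x : Fin (k + 1) → G, (∀ i, x i ∈ X i) ∧ g = (List.ofFn x).prod) ∧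
      ∑ g, v g = ∏ i, (Nat.card (X i) : ℝ) ∧
      (ℓ : ℝ) ^ k * ∑ g, centered v g ^ 2 ≤
        (Fintype.card G : ℝ) ^ k * ∏ i, indicatorVariance (X i) := by
  induction k with
  | zero =>
    refine ⟨(X 0).indicator 1, fun g hg => ⟨fun _ => g, fun i => ?_, by simp⟩, ?_, ?_⟩
    · rw [Fin.fin_one_eq_zero i]
      exact Set.mem_of_indicator_ne_zero hg
    · simp [sum_indicator_one]
    · simp [indicatorVariance]
  | succ k ih =>
    obtain ⟨v, hsupp, hsum, hvar⟩ := ih fun i => X i.succ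
    refine ⟨groupConv ((X 0).indicator 1) v, fun g hg => ?_, ?_, ?_⟩
    · obtain ⟨a, ha, z, hz, rfl⟩ := exists_eq_mul_of_groupConv_indicator_ne_zero hg
      obtain ⟨x, hx, rfl⟩ := hsupp z hz
      exact ⟨Fin.cons a x, Fin.cases ha hx, by simp [List.ofFn_succ]⟩
    · rw [sum_groupConv, sum_indicator_one, hsum, Fin.prod_univ_succ (n := k + 1)]
    · simp only [centered_groupConv]
      have h := sum_groupConv_sq_le hrep (sum_centered ((X 0).indicator 1)) (centered v)
      rw [Fin.prod_univ_succ (n := k + 1)]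
      calc _ = (ℓ : ℝ) ^ k * (ℓ * ∑ g, groupConv (centered ((X 0).indicator 1))
              (centered v) g ^ 2) := by ring
        _ ≤ (ℓ : ℝ) ^ k * (Fintype.card G * indicatorVariance (X 0)
              * ∑ g, centered v g ^ 2) := mul_le_mul_of_nonneg_left h (by positivity)
        _ = Fintype.card G * indicatorVariance (X 0)
              * ((ℓ : ℝ) ^ k * ∑ g, centered v g ^ 2) := by ring
        _ ≤ Fintype.card G * indicatorVariance (X 0)
              * ((Fintype.card G : ℝ) ^ k * ∏ i : Fin (k + 1), indicatorVariance (X i.succ)) :=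
            mul_le_mul_of_nonneg_left hvar
              (mul_nonneg (Nat.cast_nonneg _) (indicatorVariance_nonneg _))
        _ = _ := by ring

end GroupConvolution

/-- **Gowers; Babai–Nikolov–Pyber.** Let `Γ` be a finite group and `ℓ` a positive
integer such that every real linear representation of `Γ` of dimension `< ℓ` is
trivial.  If `t ≥ 3` and `X₁, …, X_t ⊆ Γ` satisfy `|X₁| ⋯ |X_t| ≥ |Γ|^t ℓ^{2-t}`,
then `X₁ ⋯ X_t = Γ`. -/
theorem product_decomposition_of_large_subsets
    (Γ : Type) [Group Γ] [Finite Γ] (ℓ : ℕ) (hℓ : 0 < ℓ)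
    (hrep : ∀ (V : Type) [AddCommGroup V] [Module ℝ V] [FiniteDimensional ℝ V],
      Module.finrank ℝ V < ℓ → ∀ ρ : Representation ℝ Γ V, ∀ g : Γ, ρ g = 1)
    (t : ℕ) (ht : 3 ≤ t) (X : Fin t → Set Γ)
    (hcard : (Nat.card Γ) ^ t ≤ (∏ i : Fin t, Nat.card (X i)) * ℓ ^ (t - 2)) :
    {g : Γ | ∃ x : Fin t → Γ, (∀ i, x i ∈ X i) ∧
      g = (List.ofFn fun i : Fin t => x i).prod} = Set.univ := by
  classical
  have := Fintype.ofFinite Γ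
  obtain ⟨k, rfl⟩ : ∃ k, t = k + 2 := ⟨t - 2, by omega⟩
  rw [Nat.add_sub_cancel, Nat.card_eq_fintype_card] at hcard
  have hn : 0 < Fintype.card Γ := Fintype.card_pos
  have hprod : 0 < ∏ i, Nat.card (X i) :=
    pos_of_mul_pos_left ((pow_pos hn _).trans_le hcard) (Nat.zero_le _)
  have hX (i) : 0 < Nat.card (X i) :=
    Nat.pos_of_ne_zero (Finset.prod_ne_zero_iff.1 hprod.ne' i (Finset.mem_univ i))
  obtain ⟨v, hsupp, hsum, hvar⟩ := exists_supported_on_prod hrep k fun i => X i.succ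
  refine Set.eq_univ_of_forall fun g => ?_
  by_cases hg : groupConv ((X 0).indicator 1) v g = 0
  · exfalso
    set n : ℝ := (Fintype.card Γ : ℝ) with hn_def
    set P : ℝ := ∏ i, (Nat.card (X i) : ℝ) with hP_def
    have hn' : 0 < n := by rw [hn_def]; exact_mod_cast hn
    have hP : 0 < P := by rw [hP_def]; exact_mod_cast hprod
    have hℓ' : (0 : ℝ) < ℓ := by exact_mod_cast hℓ
    have hcard' : n ^ (k + 2) ≤ P * ℓ ^ k := by rw [hn_def, hP_def]; exact_mod_cast hcard
    have hpoint : (P / n) ^ 2 ≤ indicatorVariance (X 0) * ∑ y, centered v y ^ 2 := by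
      have h := groupConv_sq_le (centered ((X 0).indicator 1)) (centered v) g
      rw [← centered_groupConv, centered, hg, sum_groupConv, sum_indicator_one, hsum, zero_sub,
        neg_sq] at h
      rw [hP_def, Fin.prod_univ_succ (n := k + 1)]
      exact h
    have hlt : ∏ i, indicatorVariance (X i) < P := by
      have hle : ∏ i : Fin (k + 1), indicatorVariance (X i.succ)
          ≤ ∏ i : Fin (k + 1), (Nat.card (X i.succ) : ℝ) :=
        Finset.prod_le_prod (fun i _ => indicatorVariance_nonneg _)
          fun i _ => (indicatorVariance_lt (hX _)).le
      simp only [P, Fin.prod_univ_succ (n := k + 1)]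
      have hpos : 0 < ∏ i : Fin (k + 1), (Nat.card (X i.succ) : ℝ) :=
        Finset.prod_pos fun i _ => by exact_mod_cast hX i.succ
      exact (mul_le_mul_of_nonneg_left hle (indicatorVariance_nonneg _)).trans_lt
        (mul_lt_mul_of_pos_right (indicatorVariance_lt (hX 0)) hpos)
    have hbound : ℓ ^ k * (P / n) ^ 2 < n ^ k * P := by
      calc _ ≤ (ℓ : ℝ) ^ k * (indicatorVariance (X 0) * ∑ y, centered v y ^ 2) := by gcongr
        _ = indicatorVariance (X 0) * ((ℓ : ℝ) ^ k * ∑ y, centered v y ^ 2) := by ring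
        _ ≤ indicatorVariance (X 0)
              * (n ^ k * ∏ i : Fin (k + 1), indicatorVariance (X i.succ)) :=
            mul_le_mul_of_nonneg_left hvar (indicatorVariance_nonneg _)
        _ = n ^ k * ∏ i, indicatorVariance (X i) := by
            rw [Fin.prod_univ_succ (n := k + 1)]; ring
        _ < n ^ k * P := by gcongr
    have hge : n ^ k * P ≤ ℓ ^ k * (P / n) ^ 2 := by
      rw [div_pow, ← mul_div_assoc, le_div_iff₀ (by positivity)]
      calc _ = n ^ (k + 2) * P := by ring
        _ ≤ P * ℓ ^ k * P := by gcongr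
        _ = _ := by ring
    exact absurd hge hbound.not_ge
  · obtain ⟨a, ha, z, hz, rfl⟩ := exists_eq_mul_of_groupConv_indicator_ne_zero hg
    obtain ⟨x, hx, rfl⟩ := hsupp z hz
    exact ⟨Fin.cons a x, Fin.cases ha hx, by simp [List.ofFn_succ]⟩
end
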